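/- arXiv:1112.1338 — 4 statements merged into one kernel-verified Lean document; each statement's English description precedes it below -/
import Mathlib

section
/- Under assumptions A1 (stochasticity) and A2 (self-confidence with constant η ∈ (0,1)), if the persistent graph G^p is quasi-strongly connected and there exist a constant a* > 0 and an integer T* ≥ 1 such that ∑_{s=t}^{t+T*-1} W_ij(s) ≥ a* for every t ∈ ℕ and every persistent arc (j,i), then for every initial time t0, every initial state, and all t ≥ t0, it holds that H(t + d0·T*) ≤ (1 − (η^{d0·T*}/2)·(a*/T*)^{d0}) · H(t), where d0 is the diameter of G^p. -/
open Filter Finset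

/-- `ReachIn R k i j`: `j` can be reached from `i` in exactly `k` steps following relation `R`. -/
def ReachIn {α : Type*} (R : α → α → Prop) : ℕ → α → α → Prop
  | 0 => fun i j => i = j
  | k + 1 => fun i j => ∃ m, R i m ∧ ReachIn R k m j

/-- Distance from `i` to `j`: length of a shortest directed path. -/
noncomputable def distR {α : Type*} (R : α → α → Prop) (i j : α) : ℕ :=
  sInf {k | ReachIn R k i j}

/-- Diameter: maximum of `distR i j` over pairs with `j` reachable from `i`. -/
noncomputable def diamR {α : Type*} (R : α → α → Prop) : ℕ :=
  sSup {d | ∃ i j, (∃ k, ReachIn R k i j) ∧ d = distR R i j}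

/-- Discrete-time belief evolution trajectory starting at time `t0`. -/
def DTraj (n : ℕ) (W : ℕ → Fin n → Fin n → ℝ) (t0 : ℕ) (x : ℕ → Fin n → ℝ) : Prop :=
  ∀ t, t0 ≤ t → ∀ i, x (t + 1) i = ∑ j, W t i j * x t j

/-- Maximum state Ψ(t). -/
noncomputable def dMax (n : ℕ) (x : ℕ → Fin n → ℝ) (t : ℕ) : ℝ := ⨆ i, x t i

/-- Minimum state ψ(t). -/
noncomputable def dMin (n : ℕ) (x : ℕ → Fin n → ℝ) (t : ℕ) : ℝ := ⨅ i, x t i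

/-- Agreement measure H(t) = Ψ(t) − ψ(t). -/
noncomputable def dH (n : ℕ) (x : ℕ → Fin n → ℝ) (t : ℕ) : ℝ := dMax n x t - dMin n x t

/-- `(j,i)` is a persistent arc: `j ≠ i` and `∑_{t=0}^∞ W_ij(t) = ∞`. -/
def DPersistent (n : ℕ) (W : ℕ → Fin n → Fin n → ℝ) (j i : Fin n) : Prop :=
  j ≠ i ∧ Tendsto (fun T => ∑ t ∈ Finset.range T, W t i j) atTop atTop

/-- The persistent graph is quasi-strongly connected: it has a center. -/
def DQSC (n : ℕ) (W : ℕ → Fin n → Fin n → ℝ) : Prop :=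
  ∃ c : Fin n, ∀ v : Fin n, ∃ k, ReachIn (DPersistent n W) k c v

/-- Global agreement for the discrete-time evolution. -/
def DAgree (n : ℕ) (W : ℕ → Fin n → Fin n → ℝ) : Prop :=
  ∀ t0 : ℕ, ∀ x : ℕ → Fin n → ℝ, DTraj n W t0 x → Tendsto (dH n x) atTop (nhds 0)

/-- Global ε-agreement for the discrete-time evolution. -/
def DEpsAgree (n : ℕ) (W : ℕ → Fin n → Fin n → ℝ) : Prop :=
  ∃ ε : ℝ, 0 < ε ∧ ε < 1 ∧ ∃ T0 : ℕ, 1 ≤ T0 ∧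
    ∀ t0 : ℕ, ∀ x : ℕ → Fin n → ℝ, DTraj n W t0 x →
      ∀ t, t0 ≤ t → dH n x (t + T0) ≤ ε * dH n x t

/-- Condition (b): uniformly positive weight sums over windows of length `T` for persistent arcs. -/
def DArcCond (n : ℕ) (W : ℕ → Fin n → Fin n → ℝ) : Prop :=
  ∃ a : ℝ, 0 < a ∧ ∃ T : ℕ, 1 ≤ T ∧
    ∀ t : ℕ, ∀ j i : Fin n, DPersistent n W j i →
      a ≤ ∑ s ∈ Finset.Ico t (t + T), W s i j

/-- ξ⁺(t;m) = ∑_{j ≠ m} W_mj(t). -/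
def dXi (n : ℕ) (W : ℕ → Fin n → Fin n → ℝ) (t : ℕ) (m : Fin n) : ℝ :=
  ∑ j ∈ Finset.univ.erase m, W t m j

theorem aux_dist_le (n : ℕ) (R : Fin n → Fin n → Prop) (i j : Fin n) (h : ∃ k, ReachIn R k i j) :
    ∃ k, k ≤ diamR R ∧ ReachIn R k i j := by
  refine ⟨distR R i j, ?_, Nat.sInf_mem h⟩
  refine le_csSup ?_ ⟨i, j, h, rfl⟩
  refine (Set.Finite.subset (Set.finite_range (fun p : Fin n × Fin n => distR R p.1 p.2)) ?_).bddAbove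
  rintro d ⟨i, j, _, rfl⟩
  exact ⟨(i, j), rfl⟩

section
variable {n : ℕ} {W : ℕ → Fin n → Fin n → ℝ} {η a : ℝ} {T : ℕ}

theorem aux_nonneg (hW0 : ∀ t i j, 0 ≤ W t i j) {t : ℕ} {y : ℕ → Fin n → ℝ}
    (hy : DTraj n W t y) (h0 : ∀ i, 0 ≤ y t i) (s : ℕ) : ∀ i, 0 ≤ y (t + s) i := by
  induction s with
  | zero => exact h0
  | succ s ih =>
    intro i
    rw [← add_assoc, hy (t + s) (by omega)]
    exact Finset.sum_nonneg fun j _ => mul_nonneg (hW0 _ _ _) (ih j)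

theorem aux_step (hW0 : ∀ t i j, 0 ≤ W t i j) {t : ℕ} {y : ℕ → Fin n → ℝ}
    (hy : DTraj n W t y) (h0 : ∀ i, 0 ≤ y t i) (s : ℕ) (i j : Fin n) :
    W (t + s) i j * y (t + s) j ≤ y (t + s + 1) i := by
  rw [hy (t + s) (by omega) i]
  exact Finset.single_le_sum (f := fun j => W (t + s) i j * y (t + s) j)
    (fun j _ => mul_nonneg (hW0 _ _ _) (aux_nonneg hW0 hy h0 s j)) (Finset.mem_univ j)

theorem aux_self (hW0 : ∀ t i j, 0 ≤ W t i j) (hη0 : 0 < η)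
    (hA2 : ∀ t i, η ≤ W t i i) {t : ℕ} {y : ℕ → Fin n → ℝ}
    (hy : DTraj n W t y) (h0 : ∀ i, 0 ≤ y t i) (i : Fin n) (s : ℕ) :
    η ^ s * y t i ≤ y (t + s) i := by
  induction s with
  | zero => simp
  | succ s ih =>
    have h1 := aux_step hW0 hy h0 s i i
    have h2 := mul_le_mul_of_nonneg_right (hA2 (t + s) i) (aux_nonneg hW0 hy h0 s i)
    have h3 := mul_le_mul_of_nonneg_left ih hη0.le
    rw [← add_assoc, pow_succ']
    linarith

theorem aux_shift {t : ℕ} {y : ℕ → Fin n → ℝ} (hy : DTraj n W t y) (s : ℕ) :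
    DTraj n W (t + s) y := fun u hu i => hy u (by omega) i

theorem aux_arc (hW0 : ∀ t i j, 0 ≤ W t i j) (hη0 : 0 < η) (hη1 : η < 1)
    (hA2 : ∀ t i, η ≤ W t i i) (ha : 0 < a) (hT : 1 ≤ T) {t : ℕ} {y : ℕ → Fin n → ℝ}
    (hy : DTraj n W t y) (h0 : ∀ i, 0 ≤ y t i) (j i : Fin n)
    (harc : a ≤ ∑ s ∈ Finset.Ico t (t + T), W s i j) :
    η ^ T * (a / T) * y t j ≤ y (t + T) i := by
  have hT0 : (0 : ℝ) < T := by exact_mod_cast hT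
  obtain ⟨s, hs, hsa⟩ : ∃ s ∈ Finset.Ico t (t + T), a / T ≤ W s i j := by
    by_contra! hcon
    have : ∑ s ∈ Finset.Ico t (t + T), W s i j < ∑ s ∈ Finset.Ico t (t + T), a / T :=
      Finset.sum_lt_sum_of_nonempty (by simp; omega) hcon
    rw [Finset.sum_const, Nat.card_Ico, nsmul_eq_mul, Nat.add_sub_cancel_left,
      mul_div_cancel₀ _ hT0.ne'] at this
    linarith
  rw [Finset.mem_Ico] at hs
  obtain ⟨u, rfl⟩ := Nat.exists_eq_add_of_le hs.1
  obtain ⟨v, rfl⟩ : ∃ v, T = u + 1 + v := ⟨T - (u + 1), by omega⟩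
  have haT : 0 ≤ a / ((u + 1 + v : ℕ) : ℝ) := by positivity
  set b := a / ((u + 1 + v : ℕ) : ℝ)
  have h1 := aux_self hW0 hη0 hA2 hy h0 j u
  have h2 := aux_step hW0 hy h0 u i j
  have h3 := aux_self hW0 hη0 hA2 (aux_shift hy (u + 1)) (aux_nonneg hW0 hy h0 (u + 1)) i v
  have e : t + (u + 1 + v) = t + (u + 1) + v := by omega
  rw [e]
  refine le_trans ?_ h3
  have h4 : b * (η ^ u * y t j) ≤ y (t + (u + 1)) i :=
    le_trans (mul_le_mul hsa h1 (mul_nonneg (by positivity) (h0 j)) (hW0 _ _ _)) h2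
  have h5 := mul_le_mul_of_nonneg_left h4 (pow_nonneg hη0.le v)
  refine le_trans ?_ h5
  have h6 : 0 ≤ η ^ v * (b * (η ^ u * y t j)) :=
    mul_nonneg (by positivity) (mul_nonneg haT (mul_nonneg (by positivity) (h0 j)))
  have h7 : η ^ (u + 1 + v) * b * y t j = η * (η ^ v * (b * (η ^ u * y t j))) := by ring
  rw [h7]
  nlinarith

theorem aux_path (hW0 : ∀ t i j, 0 ≤ W t i j) (hη0 : 0 < η) (hη1 : η < 1)
    (hA2 : ∀ t i, η ≤ W t i i) (ha : 0 < a) (hT : 1 ≤ T)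
    (harc : ∀ t : ℕ, ∀ j i : Fin n, DPersistent n W j i →
      a ≤ ∑ s ∈ Finset.Ico t (t + T), W s i j) {y : ℕ → Fin n → ℝ} (k : ℕ) :
    ∀ (t : ℕ) (_ : DTraj n W t y) (_ : ∀ i, 0 ≤ y t i) (j i : Fin n),
    ReachIn (DPersistent n W) k j i →
    η ^ (k * T) * (a / T) ^ k * y t j ≤ y (t + k * T) i := by
  induction k with
  | zero =>
    rintro t hy h0 j i (rfl : j = i)
    simp
  | succ k ih =>
    rintro t hy h0 j i ⟨m, hm, hr⟩
    have h1 := aux_arc hW0 hη0 hη1 hA2 ha hT hy h0 j m (harc t j m hm)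
    have h2 := ih (t + T) (aux_shift hy T) (aux_nonneg hW0 hy h0 T) m i hr
    have e : t + (k + 1) * T = t + T + k * T := by ring
    rw [e]
    refine le_trans ?_ h2
    have h3 := mul_le_mul_of_nonneg_left h1 (a := η ^ (k * T) * (a / T) ^ k) (by positivity)
    refine le_trans (le_of_eq ?_) h3
    ring

theorem aux_core (hn : 2 ≤ n) (hW0 : ∀ t i j, 0 ≤ W t i j)
    (hA1 : ∀ t i, ∑ j, W t i j = 1) (hη0 : 0 < η) (hη1 : η < 1)
    (hA2 : ∀ t i, η ≤ W t i i) (ha : 0 < a) (hT : 1 ≤ T)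
    (harc : ∀ t : ℕ, ∀ j i : Fin n, DPersistent n W j i →
      a ≤ ∑ s ∈ Finset.Ico t (t + T), W s i j) {y : ℕ → Fin n → ℝ}
    (c : Fin n) (hc : ∀ v : Fin n, ∃ k, ReachIn (DPersistent n W) k c v)
    (t : ℕ) (hy : DTraj n W t y) (h0 : ∀ i, 0 ≤ y t i) (i : Fin n) :
    η ^ (diamR (DPersistent n W) * T) * (a / T) ^ (diamR (DPersistent n W)) * y t c
      ≤ y (t + diamR (DPersistent n W) * T) i := by
  have hT0 : (0 : ℝ) < T := by exact_mod_cast hT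
  have hb : a / T ≤ 1 := by
    rw [div_le_one hT0]
    have : Nontrivial (Fin n) := Fin.nontrivial_iff_two_le.mpr hn
    obtain ⟨v, hv⟩ := exists_ne c
    obtain ⟨k, hk⟩ := hc v
    cases k with
    | zero => exact absurd hk hv.symm
    | succ k =>
      obtain ⟨m, hm, _⟩ := hk
      refine (harc 0 c m hm).trans ?_
      calc ∑ s ∈ Finset.Ico 0 (0 + T), W s m c ≤ ∑ s ∈ Finset.Ico 0 (0 + T), (1 : ℝ) :=
            Finset.sum_le_sum fun s _ => (Finset.single_le_sum (f := fun j => W s m j)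
              (fun j _ => hW0 s m j) (Finset.mem_univ c)).trans (hA1 s m).le
        _ = T := by simp
  obtain ⟨k, hk, hr⟩ := aux_dist_le n _ c i (hc i)
  obtain ⟨l, hl⟩ := Nat.exists_eq_add_of_le hk
  rw [hl]
  have h1 := aux_path hW0 hη0 hη1 hA2 ha hT harc k t hy h0 c i hr
  have h2 := aux_self hW0 hη0 hA2 (aux_shift hy (k * T)) (aux_nonneg hW0 hy h0 (k * T)) i (l * T)
  have e : t + (k + l) * T = t + k * T + l * T := by ring
  rw [e]
  refine le_trans ?_ h2
  have h3 := mul_le_mul_of_nonneg_left h1 (pow_nonneg hη0.le (l * T))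
  refine le_trans ?_ h3
  have h4 : (a / T) ^ l ≤ 1 := pow_le_one₀ (by positivity) hb
  have h5 : 0 ≤ η ^ (l * T) * (η ^ (k * T) * (a / T) ^ k * y t c) :=
    mul_nonneg (by positivity) (mul_nonneg (by positivity) (h0 c))
  have h6 := mul_le_mul_of_nonneg_right h4 h5
  refine le_trans (le_of_eq ?_) (h6.trans (one_mul _).le)
  ring

end

/-- Under A1 and A2, if the persistent graph is quasi-strongly connected and the
window condition holds, then H(t + d0·T*) ≤ (1 − (η^{d0·T*}/2)·(a*/T*)^{d0})·H(t). -/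
theorem discrete_convergence_rate
    (n : ℕ) (hn : 2 ≤ n) (W : ℕ → Fin n → Fin n → ℝ)
    (hW0 : ∀ t i j, 0 ≤ W t i j)
    (hA1 : ∀ t i, ∑ j, W t i j = 1)
    (η : ℝ) (hη0 : 0 < η) (hη1 : η < 1)
    (hA2 : ∀ t i, η ≤ W t i i)
    (hQSC : DQSC n W)
    (a : ℝ) (ha : 0 < a) (T : ℕ) (hT : 1 ≤ T)
    (harc : ∀ t : ℕ, ∀ j i : Fin n, DPersistent n W j i →
      a ≤ ∑ s ∈ Finset.Ico t (t + T), W s i j) :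
    ∀ t0 : ℕ, ∀ x : ℕ → Fin n → ℝ, DTraj n W t0 x → ∀ t, t0 ≤ t →
      dH n x (t + diamR (DPersistent n W) * T) ≤
        (1 - η ^ (diamR (DPersistent n W) * T) / 2 * (a / (T : ℝ)) ^ diamR (DPersistent n W))
          * dH n x t := by
  intro t0 x hx t ht
  obtain ⟨c, hc⟩ := hQSC
  have : Nonempty (Fin n) := ⟨c⟩
  have hxt : DTraj n W t x := fun u hu i => hx u (by omega) i
  have hM : ∀ i, x t i ≤ dMax n x t := fun i => le_ciSup (Set.finite_range (x t)).bddAbove i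
  have hm : ∀ i, dMin n x t ≤ x t i := fun i => ciInf_le (Set.finite_range (x t)).bddBelow i
  have hy1 : DTraj n W t (fun s i => dMax n x t - x s i) := by
    intro u hu i
    simp only [mul_sub, Finset.sum_sub_distrib, ← Finset.sum_mul, hA1, one_mul, hxt u hu i]
  have hy2 : DTraj n W t (fun s i => x s i - dMin n x t) := by
    intro u hu i
    simp only [mul_sub, Finset.sum_sub_distrib, ← Finset.sum_mul, hA1, one_mul, hxt u hu i]
  have p1 : ∀ i, 0 ≤ dMax n x t - x t i := fun i => sub_nonneg.2 (hM i)
  have p2 : ∀ i, 0 ≤ x t i - dMin n x t := fun i => sub_nonneg.2 (hm i)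
  have n1 := aux_nonneg hW0 hy1 p1 (diamR (DPersistent n W) * T)
  have n2 := aux_nonneg hW0 hy2 p2 (diamR (DPersistent n W) * T)
  have c1 := aux_core hn hW0 hA1 hη0 hη1 hA2 ha hT harc c hc t hy1 p1
  have c2 := aux_core hn hW0 hA1 hη0 hη1 hA2 ha hT harc c hc t hy2 p2
  have hE : 0 ≤ η ^ (diamR (DPersistent n W) * T) * (a / T) ^ (diamR (DPersistent n W)) := by
    positivity
  have eE : η ^ (diamR (DPersistent n W) * T) / 2 * (a / T) ^ (diamR (DPersistent n W))
    = η ^ (diamR (DPersistent n W) * T) * (a / T) ^ (diamR (DPersistent n W)) / 2 := by ring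
  rw [eE]
  generalize η ^ (diamR (DPersistent n W) * T) * (a / T) ^ (diamR (DPersistent n W)) = E at *
  generalize t + diamR (DPersistent n W) * T = t' at *
  have key : ∀ u l : ℝ, (∀ i, x t' i ≤ u) → (∀ i, l ≤ x t' i) → dH n x t' ≤ u - l :=
    fun u l hu hl => sub_le_sub (ciSup_le hu) (le_ciInf hl)
  have hH : dH n x t = dMax n x t - dMin n x t := rfl
  rw [hH]
  rcases le_total (x t c) ((dMax n x t + dMin n x t) / 2) with h | h
  · refine (key (dMax n x t - E * (dMax n x t - x t c)) (dMin n x t)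
      (fun i => by linarith [c1 i]) (fun i => by linarith [n2 i])).trans ?_
    nlinarith
  · refine (key (dMax n x t) (dMin n x t + E * (x t c - dMin n x t))
      (fun i => by linarith [n1 i]) (fun i => by linarith [c2 i])).trans ?_
    nlinarith
end

section
/- Under assumptions A1 (stochasticity) and A3 (arc balance with constant A > 1), if the discrete-time belief evolution achieves global ε-agreement, then there exist a constant a* > 0 and an integer T* ≥ 1 such that ∑_{s=t}^{t+T*-1} W_ij(s) ≥ a* for every t ∈ ℕ and every persistent arc (j,i) of G^p. -/
open Filter Finset

lemma aux_traj (n : ℕ) (W : ℕ → Fin n → Fin n → ℝ)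
    (hW0 : ∀ t i j, 0 ≤ W t i j) (hA1 : ∀ t i, ∑ j, W t i j = 1)
    (t T0 : ℕ) (η : ℝ) (hη : 0 ≤ η)
    (hs : ∀ s, t ≤ s → s < t + T0 → ∀ i j, j ≠ i → W s i j ≤ η)
    (x : ℕ → Fin n → ℝ) (hx : DTraj n W t x) (h0 : ∀ i, 0 ≤ x t i ∧ x t i ≤ 1) :
    ∀ k, k ≤ T0 → ∀ i, (0 ≤ x (t + k) i ∧ x (t + k) i ≤ 1) ∧
      |x (t + k) i - x t i| ≤ k * (n * η) := by
  intro k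
  induction k with
  | zero => intro _ i; simpa using h0 i
  | succ k ih =>
    intro hk i
    have ih := ih (by omega)
    have e : x (t + (k + 1)) i = ∑ j, W (t + k) i j * x (t + k) j := hx (t + k) (by omega) i
    have e2 : x (t + (k + 1)) i - x (t + k) i
        = ∑ j, W (t + k) i j * (x (t + k) j - x (t + k) i) := by
      simp only [mul_sub, Finset.sum_sub_distrib]
      rw [← Finset.sum_mul, hA1, e, one_mul]
    have b : |x (t + (k + 1)) i - x (t + k) i| ≤ n * η := by
      rw [e2]
      refine (Finset.abs_sum_le_sum_abs _ _).trans ?_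
      have : ∑ j : Fin n, |W (t + k) i j * (x (t + k) j - x (t + k) i)| ≤ ∑ j : Fin n, η := by
        refine Finset.sum_le_sum fun j _ => ?_
        by_cases hj : j = i
        · subst hj; simpa using hη
        · rw [abs_mul, abs_of_nonneg (hW0 _ _ _)]
          have h1 := hs (t + k) (by omega) (by omega) i j hj
          have h2 : |x (t + k) j - x (t + k) i| ≤ 1 := by
            have := (ih j).1
            have := (ih i).1
            rw [abs_le]; constructor <;> linarith
          calc _ ≤ η * 1 := mul_le_mul h1 h2 (abs_nonneg _) hη
            _ = η := mul_one _
      simpa using this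
    refine ⟨⟨?_, ?_⟩, ?_⟩
    · rw [e]
      exact Finset.sum_nonneg fun j _ => mul_nonneg (hW0 _ _ _) (ih j).1.1
    · rw [e, ← hA1 (t + k) i]
      exact Finset.sum_le_sum fun j _ => mul_le_of_le_one_right (hW0 _ _ _) (ih j).1.2
    · have := abs_sub_le (x (t + (k + 1)) i) (x (t + k) i) (x t i)
      have := (ih i).2
      push_cast
      linarith

lemma aux_exists (n : ℕ) (W : ℕ → Fin n → Fin n → ℝ) (t : ℕ) (x0 : Fin n → ℝ) :
    ∃ x, DTraj n W t x ∧ x t = x0 := by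
  let X : ℕ → Fin n → ℝ := fun k =>
    Nat.rec x0 (fun k v i => ∑ j, W (t + k) i j * v j) k
  refine ⟨fun s => X (s - t), ?_, ?_⟩
  · intro s hs i
    obtain ⟨k, rfl⟩ := Nat.exists_eq_add_of_le hs
    have h1 : t + k + 1 - t = k + 1 := by omega
    have h2 : t + k - t = k := by omega
    simp only [h1, h2]
    rfl
  · simp [X]

lemma aux_nonpers (n : ℕ) (W : ℕ → Fin n → Fin n → ℝ) (hW0 : ∀ t i j, 0 ≤ W t i j)
    (η : ℝ) (hη : 0 < η) :
    ∃ M, ∀ s, M ≤ s → ∀ i j, j ≠ i → ¬ DPersistent n W j i → W s i j ≤ η := by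
  rw [← eventually_atTop (p := fun s => ∀ i j, j ≠ i → ¬ DPersistent n W j i → W s i j ≤ η)]
  rw [eventually_all]; intro i
  rw [eventually_all]; intro j
  by_cases hj : j ≠ i ∧ ¬ DPersistent n W j i
  · have hn : ¬ Tendsto (fun T => ∑ t ∈ Finset.range T, W t i j) atTop atTop :=
      fun h => hj.2 ⟨hj.1, h⟩
    have hsum : Summable (fun t => W t i j) := by
      by_contra h
      exact hn ((not_summable_iff_tendsto_nat_atTop_of_nonneg (fun t => hW0 t i j)).1 h)
    filter_upwards [hsum.tendsto_atTop_zero.eventually (eventually_le_nhds hη)] with s hs _ _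
    exact hs
  · exact Eventually.of_forall fun s h1 h2 => absurd ⟨h1, h2⟩ hj

/-- Under A1 and A3, global ε-agreement implies condition (b). -/
theorem discrete_eps_agreement_implies_arc_condition
    (n : ℕ) (hn : 2 ≤ n) (W : ℕ → Fin n → Fin n → ℝ)
    (hW0 : ∀ t i j, 0 ≤ W t i j)
    (hA1 : ∀ t i, ∑ j, W t i j = 1)
    (A : ℝ) (hA : 1 < A)
    (hA3 : ∀ t : ℕ, ∀ i j k m : Fin n, DPersistent n W j i → DPersistent n W m k →
      A⁻¹ * W t i j ≤ W t k m ∧ W t k m ≤ A * W t i j)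
    (heps : DEpsAgree n W) :
    DArcCond n W := by
  obtain ⟨ε, hε0, hε1, T0, hT0, H⟩ := heps
  have hT0' : (1 : ℝ) ≤ T0 := by exact_mod_cast hT0
  have hn' : (2 : ℝ) ≤ n := by exact_mod_cast hn
  have hpos : (0 : ℝ) < 4 * n * T0 := by positivity
  set η : ℝ := (1 - ε) / (4 * n * T0) with hηd
  have hη : 0 < η := div_pos (by linarith) hpos
  have hη2 : T0 * (n * η) = (1 - ε) / 4 := by
    rw [hηd]; field_simp
  obtain ⟨M, hM⟩ := aux_nonpers n W hW0 η hη
  have hA0 : 0 < A := by linarith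
  refine ⟨η / A, div_pos hη hA0, M + T0, by omega, ?_⟩
  intro t j i hp
  have hsub : ∑ s ∈ Finset.Ico (t + M) (t + M + T0), W s i j
      ≤ ∑ s ∈ Finset.Ico t (t + (M + T0)), W s i j := by
    refine Finset.sum_le_sum_of_subset_of_nonneg ?_ (fun s _ _ => hW0 s i j)
    intro s hs
    simp only [Finset.mem_Ico] at hs ⊢
    omega
  refine le_trans ?_ hsub
  by_contra hlt
  push Not at hlt
  have small : ∀ s, t + M ≤ s → s < t + M + T0 → ∀ k m, m ≠ k → W s k m ≤ η := by
    intro s h1 h2 k m hm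
    by_cases hkm : DPersistent n W m k
    · have h3 := (hA3 s i j k m hp hkm).2
      have h4 : W s i j ≤ ∑ s ∈ Finset.Ico (t + M) (t + M + T0), W s i j :=
        Finset.single_le_sum (f := fun s => W s i j) (fun s _ => hW0 s i j)
          (Finset.mem_Ico.2 ⟨h1, h2⟩)
      have h5 : A * W s i j ≤ A * (η / A) := mul_le_mul_of_nonneg_left (h4.trans hlt.le) hA0.le
      rw [mul_div_cancel₀ _ hA0.ne'] at h5
      exact h3.trans h5
    · exact hM s (by omega) k m hm hkm
  obtain ⟨x, hx, hx0⟩ := aux_exists n W (t + M) (fun k => if k = i then 1 else 0)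
  have h01 : ∀ k, 0 ≤ x (t + M) k ∧ x (t + M) k ≤ 1 := by
    intro k; rw [hx0]; dsimp only; split_ifs <;> norm_num
  have key := aux_traj n W hW0 hA1 (t + M) T0 η hη.le small x hx h01 T0 le_rfl
  have hH := H (t + M) x hx (t + M) le_rfl
  haveI : Nonempty (Fin n) := ⟨i⟩
  have hH1 : dH n x (t + M) ≤ 1 := by
    have a1 : dMax n x (t + M) ≤ 1 := ciSup_le fun k => (h01 k).2
    have a2 : 0 ≤ dMin n x (t + M) := le_ciInf fun k => (h01 k).1
    unfold dH; linarith
  have b1 : x (t + M + T0) i ≤ dMax n x (t + M + T0) :=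
    le_ciSup (f := fun k => x (t + M + T0) k) (Set.finite_range _).bddAbove i
  have b2 : dMin n x (t + M + T0) ≤ x (t + M + T0) j :=
    ciInf_le (f := fun k => x (t + M + T0) k) (Set.finite_range _).bddBelow j
  have ki := (abs_le.1 (key i).2).1
  have kj := (abs_le.1 (key j).2).2
  have xi : x (t + M) i = 1 := by rw [hx0]; simp
  have xj : x (t + M) j = 0 := by rw [hx0]; simp [hp.1]
  rw [xi, hη2] at ki
  rw [xj, hη2] at kj
  have hH2 : ε * dH n x (t + M) ≤ ε := mul_le_of_le_one_right hε0.le hH1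
  unfold dH at hH hH2
  linarith
end

section
/- Under assumption A3 (arc balance with constant A > 1), suppose the persistent graph G^p is quasi-strongly connected and there exist constants a* > 0 and τ0 > 0 such that ∫_t^{t+τ0} W_ij(s) ds ≥ a* for every t ≥ 0 and every persistent arc (j,i). Then every solution of the continuous-time belief evolution satisfies, for all t ≥ t0, H(t + τ0·⌈d0·log 2 / a*⌉) ≤ (1 − m0^{d0}/2) · H(t), where d0 is the diameter of G^p, m0 = (ω0/2)² / ((n−1)A), ω0 = exp(−∫_0^∞ θ(s) ds), and θ(t) = ∑ W_ij(t) over all ordered pairs (j,i) with j ≠ i that are not persistent arcs. -/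
open Filter Finset MeasureTheory

/-- Regularity of the weight functions: nonnegative, measurable and locally integrable. -/
def CRegular (n : ℕ) (W : ℝ → Fin n → Fin n → ℝ) : Prop :=
  (∀ t i j, 0 ≤ W t i j) ∧ (∀ i j, Measurable fun t => W t i j) ∧
    (∀ i j, LocallyIntegrable (fun t => W t i j))

/-- A (Caratheodory) solution of the continuous-time belief evolution with initial time `t0`,
written in integral form. -/
def CSol (n : ℕ) (W : ℝ → Fin n → Fin n → ℝ) (t0 : ℝ) (x : ℝ → Fin n → ℝ) : Prop :=
  (∀ i, ContinuousOn (fun t => x t i) (Set.Ici t0)) ∧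
    ∀ i : Fin n, ∀ t : ℝ, t0 ≤ t →
      x t i = x t0 i + ∫ s in t0..t, ∑ j, W s i j * (x s j - x s i)

/-- Solutions exist from every initial time `t0 ≥ 0` and every initial state. -/
def CSolExists (n : ℕ) (W : ℝ → Fin n → Fin n → ℝ) : Prop :=
  ∀ t0 : ℝ, 0 ≤ t0 → ∀ x0 : Fin n → ℝ, ∃ x : ℝ → Fin n → ℝ,
    CSol n W t0 x ∧ ∀ i, x t0 i = x0 i

/-- Maximum state Ψ(t). -/
noncomputable def cMax (n : ℕ) (x : ℝ → Fin n → ℝ) (t : ℝ) : ℝ := ⨆ i, x t i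

/-- Minimum state ψ(t). -/
noncomputable def cMin (n : ℕ) (x : ℝ → Fin n → ℝ) (t : ℝ) : ℝ := ⨅ i, x t i

/-- Agreement measure H(t) = Ψ(t) − ψ(t). -/
noncomputable def cH (n : ℕ) (x : ℝ → Fin n → ℝ) (t : ℝ) : ℝ := cMax n x t - cMin n x t

/-- `(j,i)` is a persistent arc: `j ≠ i` and `∫_s^∞ W_ij(t) dt = ∞` for every `s ≥ 0`. -/
def CPersistent (n : ℕ) (W : ℝ → Fin n → Fin n → ℝ) (j i : Fin n) : Prop :=
  j ≠ i ∧ ∀ s : ℝ, 0 ≤ s → Tendsto (fun T => ∫ t in s..T, W t i j) atTop atTop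

/-- The persistent graph is quasi-strongly connected: it has a center. -/
def CQSC (n : ℕ) (W : ℝ → Fin n → Fin n → ℝ) : Prop :=
  ∃ c : Fin n, ∀ v : Fin n, ∃ k, ReachIn (CPersistent n W) k c v

/-- A3 (arc balance) with constant `A`. -/
def CArcBalance (n : ℕ) (W : ℝ → Fin n → Fin n → ℝ) (A : ℝ) : Prop :=
  ∀ t : ℝ, 0 ≤ t → ∀ i j k m : Fin n, CPersistent n W j i → CPersistent n W m k →
    A⁻¹ * W t i j ≤ W t k m ∧ W t k m ≤ A * W t i j

/-- Global agreement for the continuous-time evolution. -/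
def CAgree (n : ℕ) (W : ℝ → Fin n → Fin n → ℝ) : Prop :=
  ∀ t0 : ℝ, 0 ≤ t0 → ∀ x : ℝ → Fin n → ℝ, CSol n W t0 x →
    Tendsto (cH n x) atTop (nhds 0)

/-- Global ε-agreement for the continuous-time evolution. -/
def CEpsAgree (n : ℕ) (W : ℝ → Fin n → Fin n → ℝ) : Prop :=
  ∃ ε : ℝ, 0 < ε ∧ ε < 1 ∧ ∃ T0 : ℝ, 0 < T0 ∧
    ∀ t0 : ℝ, 0 ≤ t0 → ∀ x : ℝ → Fin n → ℝ, CSol n W t0 x →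
      ∀ t, t0 ≤ t → cH n x (t + T0) ≤ ε * cH n x t

/-- Condition (b): uniformly positive integrals over windows of length `τ0` for persistent arcs. -/
def CArcCond (n : ℕ) (W : ℝ → Fin n → Fin n → ℝ) : Prop :=
  ∃ a : ℝ, 0 < a ∧ ∃ τ : ℝ, 0 < τ ∧
    ∀ t : ℝ, 0 ≤ t → ∀ j i : Fin n, CPersistent n W j i →
      a ≤ ∫ s in t..(t + τ), W s i j

open scoped Classical in
/-- θ(t): total weight at time `t` over non-persistent ordered pairs of distinct nodes. -/
noncomputable def cTheta (n : ℕ) (W : ℝ → Fin n → Fin n → ℝ) (t : ℝ) : ℝ :=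
  ∑ i : Fin n, ∑ j : Fin n, if j ≠ i ∧ ¬ CPersistent n W j i then W t i j else 0

/-- ξ⁺(t;m) = ∑_{j ≠ m} W_mj(t). -/
def cXi (n : ℕ) (W : ℝ → Fin n → Fin n → ℝ) (t : ℝ) (m : Fin n) : ℝ :=
  ∑ j ∈ Finset.univ.erase m, W t m j


lemma ac_exp {G : ℝ → ℝ} {a b : ℝ} (hG : AbsolutelyContinuousOnInterval G a b) :
    AbsolutelyContinuousOnInterval (fun s => Real.exp (G s)) a b := by
  obtain ⟨C, hC⟩ := hG.exists_bound
  have hexp : ∀ u v : ℝ, u ≤ C → v ≤ C →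
      dist (Real.exp u) (Real.exp v) ≤ Real.exp C * dist u v := by
    have key : ∀ u v : ℝ, v ≤ u → u ≤ C →
        Real.exp u - Real.exp v ≤ Real.exp C * (u - v) := by
      intro u v huv hu
      have h1 : 1 + (v - u) ≤ Real.exp (v - u) := by
        have := Real.add_one_le_exp (v - u); linarith
      have h2 : Real.exp v = Real.exp u * Real.exp (v - u) := by
        rw [← Real.exp_add]; congr 1; ring
      have h3 : Real.exp u ≤ Real.exp C := Real.exp_le_exp.mpr hu
      have h4 := Real.exp_pos u
      rw [h2]
      nlinarith
    intro u v hu hv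
    rw [Real.dist_eq, Real.dist_eq]
    rcases le_total v u with h | h
    · rw [abs_of_nonneg (sub_nonneg.mpr (Real.exp_le_exp.mpr h)), abs_of_nonneg (by linarith)]
      exact key u v h hu
    · rw [abs_sub_comm, abs_sub_comm u v,
        abs_of_nonneg (sub_nonneg.mpr (Real.exp_le_exp.mpr h)), abs_of_nonneg (by linarith)]
      exact key v u h hv
  rw [absolutelyContinuousOnInterval_iff] at hG ⊢
  intro ε hε
  obtain ⟨δ, hδ, H⟩ := hG (ε / Real.exp C) (by positivity)
  refine ⟨δ, hδ, fun E hE hl => ?_⟩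
  have h1 := H E hE hl
  rw [lt_div_iff₀ (Real.exp_pos C)] at h1
  refine lt_of_le_of_lt ?_ h1
  rw [mul_comm, Finset.mul_sum]
  refine Finset.sum_le_sum fun i hi => ?_
  have hm := hE.1 i hi
  exact hexp _ _ ((le_abs_self _).trans (hC _ hm.1)) ((le_abs_self _).trans (hC _ hm.2))

lemma gron {a b : ℝ} (hab : a ≤ b) {y f g h : ℝ → ℝ}
    (hf : IntervalIntegrable f volume a b) (hg : IntervalIntegrable g volume a b)
    (hh : IntervalIntegrable h volume a b)
    (hy : y b = y a + ∫ s in a..b, f s)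
    (hle : ∀ s ∈ Set.Ioo a b, h s - g s * (y a + ∫ r in a..s, f r) ≤ f s) :
    y a + ∫ s in a..b, Real.exp (∫ r in a..s, g r) * h s
      ≤ Real.exp (∫ r in a..b, g r) * y b := by
  have hG := hg.absolutelyContinuousOnInterval_intervalIntegral (c := a) (by simp)
  have hE := ac_exp hG
  have hF := hf.absolutelyContinuousOnInterval_intervalIntegral (c := a) (by simp)
  have hY : AbsolutelyContinuousOnInterval (fun t => y a + ∫ s in a..t, f s) a b := by
    have hc : AbsolutelyContinuousOnInterval (fun _ : ℝ => y a) a b :=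
      (LipschitzWith.const (y a)).lipschitzOnWith.absolutelyContinuousOnInterval (K := 0)
    exact hc.add hF
  have key := hE.integral_deriv_mul_eq_sub hY
  have hmono : ∫ s in a..b, Real.exp (∫ r in a..s, g r) * h s ≤
      ∫ x in a..b, deriv (fun s => Real.exp (∫ r in a..s, g r)) x * (y a + ∫ s in a..x, f s)
        + Real.exp (∫ r in a..x, g r) * deriv (fun t => y a + ∫ s in a..t, f s) x := by
    refine intervalIntegral.integral_mono_ae_restrict hab ?_ ?_ ?_
    · exact hh.continuousOn_mul hE.continuousOn
    · exact (hE.intervalIntegrable_deriv.mul_continuousOn hY.continuousOn).add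
        (hY.intervalIntegrable_deriv.continuousOn_mul hE.continuousOn)
    · rw [EventuallyLE, ← Measure.restrict_congr_set (Ioo_ae_eq_Icc (μ := volume) (a := a) (b := b)),
        ae_restrict_iff' measurableSet_Ioo]
      filter_upwards [hf.ae_hasDerivAt_integral, hg.ae_hasDerivAt_integral] with x h1 h2 hx
      have hx' : x ∈ Set.uIcc a b := by
        rw [Set.uIcc_of_le hab]; exact Set.Ioo_subset_Icc_self hx
      have d1 := (h1 hx' a (by simp)).const_add (y a)
      have d2 := (h2 hx' a (by simp)).exp
      rw [d1.deriv, d2.deriv]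
      have := hle x hx
      have hp := Real.exp_pos (∫ r in a..x, g r)
      nlinarith [mul_le_mul_of_nonneg_left this hp.le]
  rw [key] at hmono
  simp only [intervalIntegral.integral_same, Real.exp_zero, add_zero, one_mul] at hmono
  rw [← hy] at hmono
  linarith

lemma w_int {n : ℕ} {W : ℝ → Fin n → Fin n → ℝ} (hreg : CRegular n W) (i j : Fin n) (a b : ℝ) :
    IntervalIntegrable (fun t => W t i j) volume a b :=
  intervalIntegrable_iff.mpr
    (((hreg.2.2 i j).integrableOn_isCompact isCompact_uIcc).mono_set Set.uIoc_subset_uIcc)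

lemma ii_sum {n : ℕ} {f : Fin n → ℝ → ℝ} {a b : ℝ}
    (hf : ∀ j, IntervalIntegrable (f j) volume a b) :
    IntervalIntegrable (fun s => ∑ j, f j s) volume a b := by
  rw [intervalIntegrable_iff]
  exact integrable_finsetSum _ fun j _ => intervalIntegrable_iff.mp (hf j)

lemma rhs_int {n : ℕ} {W : ℝ → Fin n → Fin n → ℝ} (hreg : CRegular n W) {t0 : ℝ}
    {x : ℝ → Fin n → ℝ} (hx : CSol n W t0 x) {a b : ℝ} (ha : t0 ≤ a) (hab : a ≤ b) (i : Fin n) :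
    IntervalIntegrable (fun s => ∑ j, W s i j * (x s j - x s i)) volume a b := by
  have hsub : Set.uIcc a b ⊆ Set.Ici t0 := by
    rw [Set.uIcc_of_le hab]; intro s hs; exact ha.trans hs.1
  exact ii_sum fun j =>
      (w_int hreg i j a b).mul_continuousOn (((hx.1 j).sub (hx.1 i)).mono hsub)

lemma sol_shift {n : ℕ} {W : ℝ → Fin n → Fin n → ℝ} (hreg : CRegular n W) {t0 : ℝ}
    {x : ℝ → Fin n → ℝ} (hx : CSol n W t0 x) {a b : ℝ} (ha : t0 ≤ a) (hab : a ≤ b) (i : Fin n) :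
    x b i = x a i + ∫ s in a..b, ∑ j, W s i j * (x s j - x s i) := by
  rw [hx.2 i b (ha.trans hab), hx.2 i a ha, add_assoc,
    intervalIntegral.integral_add_adjacent_intervals (rhs_int hreg hx le_rfl ha i)
      (rhs_int hreg hx ha hab i)]

lemma sol_affine {n : ℕ} {W : ℝ → Fin n → Fin n → ℝ} {t0 : ℝ}
    {x : ℝ → Fin n → ℝ} (hx : CSol n W t0 x) (α β : ℝ) :
    CSol n W t0 (fun t i => α * x t i + β) := by
  refine ⟨fun i => ((hx.1 i).const_mul α).add continuousOn_const, fun i t ht => ?_⟩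
  have : ∀ s, ∑ j, W s i j * (α * x s j + β - (α * x s i + β)) =
      α * ∑ j, W s i j * (x s j - x s i) := by
    intro s; rw [Finset.mul_sum]; exact Finset.sum_congr rfl fun j _ => by ring
  simp only [this, intervalIntegral.integral_const_mul]
  rw [hx.2 i t ht]; ring

lemma sol_nonneg {n : ℕ} {W : ℝ → Fin n → Fin n → ℝ} (hreg : CRegular n W) {t0 : ℝ}
    {y : ℝ → Fin n → ℝ} (hy : CSol n W t0 y) {a : ℝ} (ha : t0 ≤ a) (h0 : ∀ i, 0 ≤ y a i)
    {b : ℝ} (hab : a ≤ b) (i : Fin n) : 0 ≤ y b i := by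
  refine le_of_forall_pos_le_add fun ε hε => ?_
  by_contra hcon
  push Not at hcon
  have hsub : Set.Icc a b ⊆ Set.Ici t0 := fun s hs => ha.trans hs.1
  let K : Set ℝ := ⋃ k : Fin n, {s ∈ Set.Icc a b | y s k + ε ∈ Set.Iic (0 : ℝ)}
  have hKc : IsCompact K := by
    refine isCompact_iUnion fun k => ?_
    refine isCompact_Icc.of_isClosed_subset ?_ (fun s hs => hs.1)
    exact (((hy.1 k).mono hsub).add continuousOn_const).preimage_isClosed_of_isClosed
      isClosed_Icc isClosed_Iic
  obtain ⟨t, ht, hmin⟩ := hKc.exists_isLeast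
    ⟨b, Set.mem_iUnion.2 ⟨i, ⟨hab, le_rfl⟩, by simp only [Set.mem_Iic]; linarith⟩⟩
  obtain ⟨k, htab, hk⟩ := Set.mem_iUnion.1 ht
  simp only [Set.mem_Iic] at hk
  have hpos : ∀ s ∈ Set.Ioo a t, ∀ j, 0 < y s j + ε := by
    intro s hs j
    by_contra hc
    have : t ≤ s := hmin (Set.mem_iUnion.2 ⟨j, ⟨hs.1.le, hs.2.le.trans htab.2⟩, not_lt.1 hc⟩)
    exact absurd hs.2 (not_lt.2 this)
  have hsol := sol_shift hreg hy ha htab.1 k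
  have hgi : IntervalIntegrable (fun s => ∑ j, W s k j) volume a t :=
    ii_sum fun j => w_int hreg k j a t
  have := gron htab.1 (y := fun s => y s k + ε) (h := fun _ => 0) (rhs_int hreg hy ha htab.1 k) hgi
    (by simp) (by rw [hsol]; ring) (by
      intro s hs
      have e := sol_shift hreg hy ha hs.1.le k
      have e2 : y a k + ε + ∫ r in a..s, ∑ j, W r k j * (y r j - y r k) = y s k + ε := by
        rw [e]; ring
      rw [e2, Finset.sum_mul, zero_sub, ← Finset.sum_neg_distrib]
      refine Finset.sum_le_sum fun j _ => ?_
      have := mul_nonneg (hreg.1 s k j) (hpos s hs j).le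
      nlinarith)
  simp only [mul_zero, intervalIntegral.integral_zero, add_zero] at this
  have h1 := Real.exp_pos (∫ r in a..t, ∑ j, W r k j)
  have h2 := h0 k
  nlinarith

/-- one interval -/
lemma sol_step {n : ℕ} {W : ℝ → Fin n → Fin n → ℝ} (hreg : CRegular n W) {t0 : ℝ}
    {y : ℝ → Fin n → ℝ} (hy : CSol n W t0 y) {a b : ℝ} (ha : t0 ≤ a) (hab : a ≤ b)
    (h0 : ∀ i, 0 ≤ y a i) {g : ℝ → ℝ} (hg : ∀ c d, IntervalIntegrable g volume c d)
    (hgle : ∀ s, t0 ≤ s → ∀ i, ∑ j ∈ Finset.univ.erase i, W s i j ≤ g s)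
    {v : ℝ} (j : Fin n) (hj : v ≤ y a j) :
    v ≤ Real.exp (∫ r in a..b, g r) * y b j ∧
    ∀ i, j ≠ i → v * (∫ s in a..b, W s i j) ≤ Real.exp (∫ r in a..b, g r) * y b i := by
  have hnn : ∀ s, a ≤ s → ∀ i, 0 ≤ y s i := fun s hs i => sol_nonneg hreg hy ha h0 hs i
  have hsum : ∀ s i, ∑ j, W s i j * (y s j - y s i) =
      ∑ j ∈ Finset.univ.erase i, W s i j * y s j - (∑ j ∈ Finset.univ.erase i, W s i j) * y s i := by
    intro s i
    rw [← Finset.add_sum_erase _ _ (Finset.mem_univ i), Finset.sum_mul, ← Finset.sum_sub_distrib]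
    simp only [sub_self, mul_zero, zero_add]
    exact Finset.sum_congr rfl fun j _ => by ring
  have hfirst : ∀ c, a ≤ c → v ≤ Real.exp (∫ r in a..c, g r) * y c j := by
    intro c hc
    have := gron hc (y := fun s => y s j) (h := fun _ => 0) (rhs_int hreg hy ha hc j) (hg a c)
      (by simp) (sol_shift hreg hy ha hc j) (by
        intro s hs
        rw [← sol_shift hreg hy ha hs.1.le j, hsum]
        have h1 := mul_le_mul_of_nonneg_right (hgle s (ha.trans hs.1.le) j) (hnn s hs.1.le j)
        have h2 : 0 ≤ ∑ k ∈ Finset.univ.erase j, W s j k * y s k :=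
          Finset.sum_nonneg fun k _ => mul_nonneg (hreg.1 _ _ _) (hnn s hs.1.le k)
        linarith)
    simp only [mul_zero, intervalIntegral.integral_zero, add_zero] at this
    linarith
  refine ⟨hfirst b hab, fun i hij => ?_⟩
  have hsub : Set.uIcc a b ⊆ Set.Ici t0 := by
    rw [Set.uIcc_of_le hab]; intro s hs; exact ha.trans hs.1
  have hhi : IntervalIntegrable (fun s => W s i j * y s j) volume a b :=
    (w_int hreg i j a b).mul_continuousOn ((hy.1 j).mono hsub)
  have := gron hab (y := fun s => y s i) (h := fun s => W s i j * y s j)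
    (rhs_int hreg hy ha hab i) (hg a b)
      hhi (sol_shift hreg hy ha hab i) (by
        intro s hs
        rw [← sol_shift hreg hy ha hs.1.le i, hsum]
        have h1 := mul_le_mul_of_nonneg_right (hgle s (ha.trans hs.1.le) i) (hnn s hs.1.le i)
        have h2 : W s i j * y s j ≤ ∑ k ∈ Finset.univ.erase i, W s i k * y s k :=
          Finset.single_le_sum (f := fun k => W s i k * y s k)
            (fun k _ => mul_nonneg (hreg.1 _ _ _) (hnn s hs.1.le k))
            (Finset.mem_erase.2 ⟨hij, Finset.mem_univ j⟩)
        linarith)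
  have hcont : ContinuousOn (fun s => Real.exp (∫ r in a..s, g r)) (Set.uIcc a b) :=
    (ac_exp ((hg a b).absolutelyContinuousOnInterval_intervalIntegral (c := a)
      (by simp))).continuousOn
  have hm : ∫ s in a..b, v * W s i j ≤
      ∫ s in a..b, Real.exp (∫ r in a..s, g r) * (W s i j * y s j) := by
    refine intervalIntegral.integral_mono_on hab ((w_int hreg i j a b).const_mul v)
      (hhi.continuousOn_mul hcont) fun s hs => ?_
    have := mul_le_mul_of_nonneg_right (hfirst s hs.1) (hreg.1 s i j)
    linarith
  rw [intervalIntegral.integral_const_mul] at hm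
  have := h0 i
  linarith

open scoped Classical in
/-- largest total persistent in-weight -/
noncomputable def cS (n : ℕ) (W : ℝ → Fin n → Fin n → ℝ) (t : ℝ) : ℝ :=
  ⨆ i : Fin n, ∑ j : Fin n, if CPersistent n W j i then W t i j else 0

open scoped Classical in
lemma cS_ge (n : ℕ) (W : ℝ → Fin n → Fin n → ℝ) (t : ℝ) (i : Fin n) :
    ∑ j : Fin n, (if CPersistent n W j i then W t i j else 0) ≤ cS n W t :=
  le_ciSup (f := fun i : Fin n => ∑ j : Fin n, if CPersistent n W j i then W t i j else 0)
    (Set.finite_range _).bddAbove i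

open scoped Classical in
lemma ite_int {n : ℕ} {W : ℝ → Fin n → Fin n → ℝ} (hreg : CRegular n W) (i j : Fin n) (P : Prop) [Decidable P]
    (a b : ℝ) : IntervalIntegrable (fun t => if P then W t i j else 0) volume a b := by
  by_cases h : P
  · simpa [h] using w_int hreg i j a b
  · simp [h]

open scoped Classical in
lemma theta_int {n : ℕ} {W : ℝ → Fin n → Fin n → ℝ} (hreg : CRegular n W) (a b : ℝ) :
    IntervalIntegrable (cTheta n W) volume a b :=
  ii_sum fun i => ii_sum fun j => ite_int hreg i j _ a b

open scoped Classical in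
lemma cS_nonneg {n : ℕ} (hn : 2 ≤ n) {W : ℝ → Fin n → Fin n → ℝ} (hreg : CRegular n W) (t : ℝ) :
    0 ≤ cS n W t := by
  refine le_trans ?_ (cS_ge n W t ⟨0, by omega⟩)
  refine Finset.sum_nonneg fun j _ => ?_
  split_ifs
  · exact hreg.1 _ _ _
  · exact le_rfl

open scoped Classical in
lemma cS_int {n : ℕ} (hn : 2 ≤ n) {W : ℝ → Fin n → Fin n → ℝ} (hreg : CRegular n W) (a b : ℝ) :
    IntervalIntegrable (cS n W) volume a b := by
  have : Nonempty (Fin n) := ⟨⟨0, by omega⟩⟩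
  have h1 : IntervalIntegrable (fun t => ∑ i : Fin n, ∑ j : Fin n, W t i j) volume a b :=
    ii_sum fun i => ii_sum fun j => w_int hreg i j a b
  refine h1.mono_fun ?_ (Eventually.of_forall fun t => ?_)
  · refine Measurable.aestronglyMeasurable ?_
    refine Measurable.iSup fun i => Finset.measurable_fun_sum _ fun j _ => ?_
    by_cases h : CPersistent n W j i
    · simpa [h] using hreg.2.1 i j
    · simp [h]
  · have h2 : ∀ i, 0 ≤ ∑ j : Fin n, W t i j := fun i => Finset.sum_nonneg fun j _ => hreg.1 t i j
    beta_reduce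
    rw [Real.norm_of_nonneg (cS_nonneg hn hreg t),
      Real.norm_of_nonneg (Finset.sum_nonneg fun i _ => h2 i)]
    refine ciSup_le fun i => ?_
    refine le_trans (Finset.sum_le_sum fun j _ => ?_)
      (Finset.single_le_sum (f := fun i => ∑ j, W t i j) (fun i _ => h2 i) (Finset.mem_univ i))
    split_ifs
    · exact le_rfl
    · exact hreg.1 _ _ _

lemma arc_le_cS {n : ℕ} {W : ℝ → Fin n → Fin n → ℝ} (hreg : CRegular n W) (t : ℝ) (i j : Fin n)
    (h : CPersistent n W j i) : W t i j ≤ cS n W t := by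
  classical
  refine le_trans ?_ (cS_ge n W t i)
  have := Finset.single_le_sum (s := Finset.univ)
    (f := fun j => if CPersistent n W j i then W t i j else 0)
    (fun k _ => by
      split_ifs
      · exact hreg.1 _ _ _
      · exact le_rfl) (Finset.mem_univ j)
  simpa [h] using this

lemma cS_le_arc {n : ℕ} (hn : 2 ≤ n) {W : ℝ → Fin n → Fin n → ℝ} (hreg : CRegular n W) {A : ℝ}
    (hA : 1 < A) (hA3 : CArcBalance n W A) {t : ℝ} (ht : 0 ≤ t) (i j : Fin n)
    (h : CPersistent n W j i) : cS n W t ≤ ((n : ℝ) - 1) * A * W t i j := by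
  classical
  have : Nonempty (Fin n) := ⟨⟨0, by omega⟩⟩
  refine ciSup_le fun k => ?_
  have h0 : 0 ≤ A * W t i j := mul_nonneg (by linarith) (hreg.1 _ _ _)
  rw [← Finset.add_sum_erase _ _ (Finset.mem_univ k), if_neg (fun hp => hp.1 rfl), zero_add]
  have := Finset.sum_le_card_nsmul (Finset.univ.erase k)
    (fun m => if CPersistent n W m k then W t k m else 0) (A * W t i j) (fun m _ => by
      split_ifs with hm
      · exact (hA3 t ht i j k m h hm).2
      · exact h0)
  refine this.trans (le_of_eq ?_)
  rw [Finset.card_erase_of_mem (Finset.mem_univ k), Finset.card_univ, Fintype.card_fin,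
    nsmul_eq_mul, Nat.cast_sub (by omega)]
  push_cast; ring

lemma node_le {n : ℕ} {W : ℝ → Fin n → Fin n → ℝ} (hreg : CRegular n W) (t : ℝ) (i : Fin n) :
    ∑ j ∈ Finset.univ.erase i, W t i j ≤ cS n W t + cTheta n W t := by
  classical
  have h1 : ∑ j : Fin n, (if j ≠ i ∧ ¬ CPersistent n W j i then W t i j else 0)
      ≤ cTheta n W t := by
    unfold cTheta
    refine le_trans (le_of_eq ?_) (Finset.single_le_sum
      (f := fun i => ∑ j : Fin n, (if j ≠ i ∧ ¬ CPersistent n W j i then W t i j else 0))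
      (fun k _ => Finset.sum_nonneg fun j _ => ?_) (Finset.mem_univ i))
    · rfl
    · split_ifs
      · exact hreg.1 _ _ _
      · exact le_rfl
  refine le_trans ?_ (add_le_add (cS_ge n W t i) h1)
  rw [← Finset.sum_add_distrib]
  refine le_trans (Finset.sum_le_sum fun j hj => ?_)
    (Finset.sum_le_sum_of_subset_of_nonneg (Finset.erase_subset i _) fun j _ _ => ?_)
  · have hj := Finset.ne_of_mem_erase hj
    by_cases h : CPersistent n W j i <;> simp [h, hj]
  · refine add_nonneg ?_ ?_
    · split_ifs
      · exact hreg.1 _ _ _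
      · exact le_rfl
    · split_ifs
      · exact hreg.1 _ _ _
      · exact le_rfl

lemma theta_nonneg {n : ℕ} {W : ℝ → Fin n → Fin n → ℝ} (hreg : CRegular n W) (t : ℝ) :
    0 ≤ cTheta n W t := by
  refine Finset.sum_nonneg fun i _ => Finset.sum_nonneg fun j _ => ?_
  split_ifs
  · exact hreg.1 _ _ _
  · exact le_rfl

lemma theta_le {n : ℕ} {W : ℝ → Fin n → Fin n → ℝ} (hreg : CRegular n W)
    (hθ : IntegrableOn (cTheta n W) (Set.Ioi (0 : ℝ))) {a b : ℝ} (ha : 0 ≤ a) (hab : a ≤ b) :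
    ∫ s in a..b, cTheta n W s ≤ ∫ s in Set.Ioi (0 : ℝ), cTheta n W s := by
  rw [intervalIntegral.integral_of_le hab]
  refine setIntegral_mono_set hθ (Eventually.of_forall fun s => theta_nonneg hreg s)
    (LE.le.eventuallyLE fun s hs => lt_of_le_of_lt ha hs.1)

lemma reach_snoc {α : Type*} {R : α → α → Prop} : ∀ (k : ℕ) (i j : α), ReachIn R (k + 1) i j →
    ∃ m, ReachIn R k i m ∧ R m j
  | 0, i, j, ⟨m, h1, h2⟩ => by
    have : m = j := h2
    exact ⟨i, rfl, this ▸ h1⟩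
  | k + 1, i, j, ⟨m, h1, h2⟩ => by
    obtain ⟨p, hp1, hp2⟩ := reach_snoc k m j h2
    exact ⟨p, ⟨m, h1, hp1⟩, hp2⟩

lemma reach_diam {n : ℕ} (R : Fin n → Fin n → Prop) (i j : Fin n) (h : ∃ k, ReachIn R k i j) :
    ∃ k, k ≤ diamR R ∧ ReachIn R k i j := by
  refine ⟨distR R i j, ?_, Nat.sInf_mem h⟩
  refine le_csSup ?_ ⟨i, j, h, rfl⟩
  refine ((Set.finite_range (fun p : Fin n × Fin n => distR R p.1 p.2)).subset ?_).bddAbove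
  rintro d ⟨i, j, -, rfl⟩
  exact ⟨(i, j), rfl⟩

lemma arc_many {n : ℕ} {W : ℝ → Fin n → Fin n → ℝ} (hreg : CRegular n W)
    {a τ : ℝ} (hτ : 0 < τ) {i j : Fin n}
    (harc : ∀ t : ℝ, 0 ≤ t → a ≤ ∫ s in t..(t + τ), W s i j) (t : ℝ) (ht : 0 ≤ t) (K : ℕ) :
    K * a ≤ ∫ s in t..(t + τ * K), W s i j := by
  induction K with
  | zero => simp
  | succ K ih =>
    rw [← intervalIntegral.integral_add_adjacent_intervals (w_int hreg i j t (t + τ * K))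
      (w_int hreg i j _ _)]
    have := harc (t + τ * K) (by positivity)
    have e : t + τ * ((K + 1 : ℕ) : ℝ) = t + τ * K + τ := by push_cast; ring
    rw [e]; push_cast; linarith

lemma key {n : ℕ} (hn : 2 ≤ n) {W : ℝ → Fin n → Fin n → ℝ} (hreg : CRegular n W)
    {A : ℝ} (hA : 1 < A) (hA3 : CArcBalance n W A)
    (hθ : IntegrableOn (cTheta n W) (Set.Ioi (0 : ℝ)))
    {c : Fin n} (hc : ∀ v : Fin n, ∃ k, ReachIn (CPersistent n W) k c v)
    {t0 : ℝ} (ht0 : 0 ≤ t0) {y : ℝ → Fin n → ℝ} (hy : CSol n W t0 y) {t : ℝ} (ht : t0 ≤ t)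
    {T : ℝ} (htT : t ≤ T)
    (hT : (diamR (CPersistent n W) : ℝ) * Real.log 2 ≤ ∫ s in t..T, cS n W s)
    (h0 : ∀ i, 0 ≤ y t i) {v : ℝ} (hv0 : 0 ≤ v) (hv : v ≤ y t c) (i : Fin n) :
    ((Real.exp (-(∫ s in Set.Ioi (0 : ℝ), cTheta n W s)) / 2) ^ 2
              * (1 / (((n : ℝ) - 1) * A))) ^ diamR (CPersistent n W) * v ≤ y T i := by
  set Θ := ∫ s in Set.Ioi (0 : ℝ), cTheta n W s with hΘ
  set d := diamR (CPersistent n W) with hd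
  set m := (Real.exp (-Θ) / 2) ^ 2 * (1 / (((n : ℝ) - 1) * A)) with hm
  have hn1 : (1 : ℝ) ≤ (n : ℝ) - 1 := by
    have : (2 : ℝ) ≤ n := by exact_mod_cast hn
    linarith
  have hB : 1 < ((n : ℝ) - 1) * A := by nlinarith
  set B := ((n : ℝ) - 1) * A with hBdef
  have hΘ0 : 0 ≤ Θ := setIntegral_nonneg measurableSet_Ioi fun s _ => theta_nonneg hreg s
  have hlog : (1 : ℝ) / 2 ≤ Real.log 2 := by have := Real.log_two_gt_d9; linarith
  have hlogpos : 0 < Real.log 2 := by linarith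
  have hω : Real.exp (-Θ) ≤ 1 := Real.exp_le_one_iff.2 (by linarith)
  have hω0 := Real.exp_pos (-Θ)
  have hm0 : 0 ≤ m := by positivity
  set ω := Real.exp (-Θ) with hωdef
  -- the two factors
  have hm1 : m ≤ ω / 2 := by
    have : 1 / B ≤ 1 := by rw [div_le_one (by linarith)]; linarith
    have h2 : (ω / 2) ^ 2 ≤ ω / 2 := by nlinarith
    calc m ≤ (ω / 2) ^ 2 * 1 := by rw [hm]; gcongr
      _ ≤ ω / 2 := by linarith
  have hm2 : m ≤ ω / 2 * (Real.log 2 / B) := by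
    have h2 : (ω / 2) ^ 2 ≤ ω / 2 * Real.log 2 := by nlinarith
    have hB0 : 0 ≤ 1 / B := by positivity
    calc m ≤ (ω / 2 * Real.log 2) * (1 / B) := by rw [hm]; gcongr
      _ = _ := by ring
  -- times
  let F : ℝ → ℝ := fun s => ∫ r in t..s, cS n W r
  have hFc : ContinuousOn F (Set.Icc t T) := by
    have := ((cS_int hn hreg t T).absolutelyContinuousOnInterval_intervalIntegral (c := t)
      (by simp)).continuousOn
    rwa [Set.uIcc_of_le htT] at this
  have hFm : ∀ p q, p ≤ q → F q = F p + ∫ r in p..q, cS n W r := fun p q _ =>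
    (intervalIntegral.integral_add_adjacent_intervals (cS_int hn hreg t p)
      (cS_int hn hreg p q)).symm
  have hFt : F t = 0 := by simp [F]
  have hex : ∀ k : ℕ, k ≤ d → ∃ s ∈ Set.Icc t T, F s = k * Real.log 2 := by
    intro k hk
    have : (k : ℝ) * Real.log 2 ∈ Set.Icc (F t) (F T) := by
      rw [hFt]
      refine ⟨by positivity, le_trans ?_ hT⟩
      have : (k : ℝ) ≤ d := by exact_mod_cast hk
      gcongr
    exact intermediate_value_Icc htT hFc this
  have main : ∀ k : ℕ, k ≤ d → ∃ s ∈ Set.Icc t T, F s = k * Real.log 2 ∧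
      ∀ w, (∃ l, l ≤ k ∧ ReachIn (CPersistent n W) l c w) → m ^ k * v ≤ y s w := by
    intro k
    induction k with
    | zero =>
      intro _
      refine ⟨t, ⟨le_rfl, htT⟩, by simp [hFt], ?_⟩
      rintro w ⟨l, hl, hr⟩
      obtain rfl : l = 0 := by omega
      have : c = w := hr
      subst this
      simpa using hv
    | succ k ih =>
      intro hk
      obtain ⟨p, hp, hFp, hw⟩ := ih (by omega)
      obtain ⟨q, hq, hFq⟩ := hex (k + 1) hk
      refine ⟨q, hq, hFq, ?_⟩
      have hpq : p ≤ q := by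
        by_contra hlt
        push Not at hlt
        have h1 := hFm q p hlt.le
        have h2 : 0 ≤ ∫ r in q..p, cS n W r :=
          intervalIntegral.integral_nonneg hlt.le fun s _ => cS_nonneg hn hreg s
        rw [hFp, hFq] at h1
        push_cast at h1
        linarith
      have hS : ∫ r in p..q, cS n W r = Real.log 2 := by
        have h1 := hFm p q hpq
        rw [hFp, hFq] at h1
        push_cast at h1
        linarith
      have hp0 : 0 ≤ p := (ht0.trans ht).trans hp.1
      have hgint : ∀ c d, IntervalIntegrable (fun s => cS n W s + cTheta n W s) volume c d :=
        fun c d => (cS_int hn hreg c d).add (theta_int hreg c d)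
      have hG : Real.exp (∫ r in p..q, (cS n W r + cTheta n W r)) ≤ 2 / ω := by
        rw [intervalIntegral.integral_add (cS_int hn hreg p q) (theta_int hreg p q), hS,
          Real.exp_add, Real.exp_log (by norm_num), hωdef, Real.exp_neg, div_inv_eq_mul]
        gcongr
        exact theta_le hreg hθ hp0 hpq
      have hyp : ∀ i, 0 ≤ y p i := fun i => sol_nonneg hreg hy ht h0 hp.1 i
      have hyq : ∀ i, 0 ≤ y q i := fun i => sol_nonneg hreg hy ht h0 hq.1 i
      have conv : ∀ (u z : ℝ), 0 ≤ z →
          u ≤ Real.exp (∫ r in p..q, (cS n W r + cTheta n W r)) * z → ω / 2 * u ≤ z := by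
        intro u z hz hu
        have h1 : u ≤ 2 / ω * z := hu.trans (mul_le_mul_of_nonneg_right hG hz)
        calc ω / 2 * u ≤ ω / 2 * (2 / ω * z) := by gcongr
          _ = z := by field_simp
      have hmv : 0 ≤ m ^ k * v := by positivity
      have step := fun j hj => sol_step hreg hy (ht.trans hp.1) hpq hyp hgint
        (fun s _ i => node_le hreg s i) (v := m ^ k * v) j hj
      rintro w ⟨l, hl, hr⟩
      rcases Nat.lt_or_ge l (k + 1) with hlt | hge
      · have h1 := conv _ _ (hyq w) (step w (hw w ⟨l, by omega, hr⟩)).1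
        calc m ^ (k + 1) * v = m * (m ^ k * v) := by ring
          _ ≤ ω / 2 * (m ^ k * v) := by gcongr
          _ ≤ _ := h1
      · obtain rfl : l = k + 1 := by omega
        obtain ⟨u, hu1, hu2⟩ := reach_snoc k c w hr
        have h1 := conv _ _ (hyq w) ((step u (hw u ⟨k, le_rfl, hu1⟩)).2 w hu2.1)
        have h2 : Real.log 2 / B ≤ ∫ s in p..q, W s w u := by
          rw [div_le_iff₀ (by linarith), ← hS, mul_comm,
            ← intervalIntegral.integral_const_mul]
          refine intervalIntegral.integral_mono_on hpq (cS_int hn hreg p q)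
            ((w_int hreg w u p q).const_mul B) fun s hs => ?_
          exact cS_le_arc hn hreg hA hA3 (hp0.trans hs.1) w u hu2
        calc m ^ (k + 1) * v = m * (m ^ k * v) := by ring
          _ ≤ (ω / 2 * (Real.log 2 / B)) * (m ^ k * v) := by gcongr
          _ = ω / 2 * (m ^ k * v * (Real.log 2 / B)) := by ring
          _ ≤ ω / 2 * (m ^ k * v * ∫ s in p..q, W s w u) := by gcongr
          _ ≤ _ := h1
  obtain ⟨s, hs, -, hw⟩ := main d le_rfl
  have hshift := sol_affine hy 1 (-(m ^ d * v))
  have := sol_nonneg hreg hshift (ht.trans hs.1) (fun i => by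
    have := hw i (reach_diam _ c i (hc i))
    linarith) hs.2 i
  linarith

/-- Under A3, quasi-strong connectivity of the persistent graph and condition (b),
every solution satisfies H(t + τ0·⌈d0·log 2 / a*⌉) ≤ (1 − m0^{d0}/2)·H(t), where
m0 = (ω0/2)²/((n−1)A) and ω0 = exp(−∫_0^∞ θ). -/
theorem continuous_convergence_rate
    (n : ℕ) (hn : 2 ≤ n) (W : ℝ → Fin n → Fin n → ℝ)
    (hreg : CRegular n W)
    (A : ℝ) (hA : 1 < A) (hA3 : CArcBalance n W A)
    (hθ : IntegrableOn (cTheta n W) (Set.Ioi (0 : ℝ)))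
    (hQSC : CQSC n W)
    (a : ℝ) (ha : 0 < a) (τ : ℝ) (hτ : 0 < τ)
    (harc : ∀ t : ℝ, 0 ≤ t → ∀ j i : Fin n, CPersistent n W j i →
      a ≤ ∫ s in t..(t + τ), W s i j) :
    ∀ t0 : ℝ, 0 ≤ t0 → ∀ x : ℝ → Fin n → ℝ, CSol n W t0 x → ∀ t, t0 ≤ t →
      cH n x (t + τ * ((⌈(diamR (CPersistent n W) : ℝ) * Real.log 2 / a⌉ : ℤ) : ℝ)) ≤
        (1 - ((Real.exp (-(∫ s in Set.Ioi (0 : ℝ), cTheta n W s)) / 2) ^ 2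
              * (1 / (((n : ℝ) - 1) * A))) ^ diamR (CPersistent n W) / 2) * cH n x t := by
  intro t0 ht0 x hx t ht
  have hne : Nonempty (Fin n) := ⟨⟨0, by omega⟩⟩
  obtain ⟨c, hc⟩ := hQSC
  -- a persistent arc exists
  obtain ⟨u, hu⟩ : ∃ u, CPersistent n W c u := by
    have : Nontrivial (Fin n) := Fin.nontrivial_iff_two_le.2 hn
    obtain ⟨v, hv⟩ := exists_ne c
    obtain ⟨k, hk⟩ := hc v
    cases k with
    | zero => exact absurd hk.symm hv
    | succ k => exact ⟨hk.choose, hk.choose_spec.1⟩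
  set d := diamR (CPersistent n W) with hd
  have hz : 0 ≤ (d : ℝ) * Real.log 2 / a := by
    have := Real.log_pos (x := 2) (by norm_num)
    positivity
  obtain ⟨K, hK⟩ := Int.eq_ofNat_of_zero_le (Int.ceil_nonneg hz)
  have hKle : (d : ℝ) * Real.log 2 ≤ K * a := by
    have := Int.le_ceil ((d : ℝ) * Real.log 2 / a)
    rw [hK, div_le_iff₀ ha] at this
    exact_mod_cast this
  rw [hK]
  push_cast
  have htT : t ≤ t + τ * K := by
    have : 0 ≤ τ * K := by positivity
    linarith
  have hT : (d : ℝ) * Real.log 2 ≤ ∫ s in t..(t + τ * K), cS n W s := by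
    refine hKle.trans ((arc_many hreg hτ (fun s hs => harc s hs c u hu) t (ht0.trans ht) K).trans ?_)
    exact intervalIntegral.integral_mono_on htT (w_int hreg u c _ _) (cS_int hn hreg _ _)
      fun s _ => arc_le_cS hreg s u c hu
  set m := ((Real.exp (-(∫ s in Set.Ioi (0 : ℝ), cTheta n W s)) / 2) ^ 2
              * (1 / (((n : ℝ) - 1) * A))) ^ d with hm
  have hmax : ∀ s i, x s i ≤ cMax n x s := fun s i =>
    le_ciSup (f := fun i => x s i) (Set.finite_range _).bddAbove i
  have hmin : ∀ s i, cMin n x s ≤ x s i := fun s i =>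
    ciInf_le (f := fun i => x s i) (Set.finite_range _).bddBelow i
  have hH : 0 ≤ cH n x t := sub_nonneg.2 ((hmin t c).trans (hmax t c))
  have hy1 := sol_affine hx (-1) (cMax n x t)
  have hy2 := sol_affine hx 1 (-(cMin n x t))
  have hy1n : ∀ i, 0 ≤ -1 * x t i + cMax n x t := fun i => by linarith [hmax t i]
  have hy2n : ∀ i, 0 ≤ 1 * x t i + -(cMin n x t) := fun i => by linarith [hmin t i]
  have b1 := fun i => sol_nonneg hreg hy1 ht hy1n htT i
  have b2 := fun i => sol_nonneg hreg hy2 ht hy2n htT i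
  have hHdef : cH n x t = cMax n x t - cMin n x t := rfl
  rcases le_total (x t c) ((cMax n x t + cMin n x t) / 2) with hcase | hcase
  · have k1 := fun i => key hn hreg hA hA3 hθ hc ht0 hy1 ht htT hT hy1n
      (v := cH n x t / 2) (by linarith) (by linarith) i
    rw [← hd, ← hm] at k1
    have e1 : cMax n x (t + τ * K) ≤ cMax n x t - m * (cH n x t / 2) :=
      ciSup_le fun i => by have := k1 i; linarith
    have e2 : cMin n x t ≤ cMin n x (t + τ * K) :=
      le_ciInf fun i => by have := b2 i; linarith
    have : cH n x (t + τ * K) = cMax n x (t + τ * K) - cMin n x (t + τ * K) := rfl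
    rw [this]
    linarith
  · have k1 := fun i => key hn hreg hA hA3 hθ hc ht0 hy2 ht htT hT hy2n
      (v := cH n x t / 2) (by linarith) (by linarith) i
    rw [← hd, ← hm] at k1
    have e1 : cMin n x t + m * (cH n x t / 2) ≤ cMin n x (t + τ * K) :=
      le_ciInf fun i => by have := k1 i; linarith
    have e2 : cMax n x (t + τ * K) ≤ cMax n x t :=
      ciSup_le fun i => by have := b1 i; linarith
    have : cH n x (t + τ * K) = cMax n x (t + τ * K) - cMin n x (t + τ * K) := rfl
    rw [this]
    linarith
end

section
/- Assuming solutions exist from every initial time and initial state, if the continuous-time belief evolution achieves global agreement, then the persistent graph G^p is quasi-strongly connected (no arc balance assumption is needed for this direction). -/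
open Filter Finset MeasureTheory

lemma locInt_ii {f : ℝ → ℝ} (hf : LocallyIntegrable f) (a b : ℝ) :
    IntervalIntegrable f volume a b :=
  (LocallyIntegrable.integrableOn_isCompact hf isCompact_uIcc).intervalIntegrable

lemma csol_ii {n : ℕ} {W : ℝ → Fin n → Fin n → ℝ} (hreg : CRegular n W) {t0 : ℝ}
    {x : ℝ → Fin n → ℝ} (hx : CSol n W t0 x) (i : Fin n) {r t : ℝ} (hr : t0 ≤ r) (ht : t0 ≤ t) :
    IntervalIntegrable (fun s => ∑ j, W s i j * (x s j - x s i)) volume r t := by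
  have hsub : Set.uIcc r t ⊆ Set.Ici t0 := by
    intro s hs
    exact le_trans (le_min hr ht) hs.1
  have : (fun s => ∑ j, W s i j * (x s j - x s i))
      = ∑ j, (fun s => W s i j * (x s j - x s i)) := by
    ext s; simp
  rw [this]
  apply IntervalIntegrable.sum
  intro j _
  apply IntervalIntegrable.mul_continuousOn
  · exact locInt_ii (hreg.2.2 i j) _ _
  · exact ((hx.1 j).sub (hx.1 i)).mono hsub

lemma csol_diff {n : ℕ} {W : ℝ → Fin n → Fin n → ℝ} (hreg : CRegular n W) {t0 : ℝ}
    {x : ℝ → Fin n → ℝ} (hx : CSol n W t0 x) (i : Fin n) {r t : ℝ} (hr : t0 ≤ r) (ht : t0 ≤ t) :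
    x t i - x r i = ∫ s in r..t, ∑ j, W s i j * (x s j - x s i) := by
  rw [hx.2 i t ht, hx.2 i r hr,
    ← intervalIntegral.integral_add_adjacent_intervals (csol_ii hreg hx i le_rfl hr)
      (csol_ii hreg hx i hr ht)]
  ring

lemma csol_neg {n : ℕ} {W : ℝ → Fin n → Fin n → ℝ} {t0 : ℝ}
    {x : ℝ → Fin n → ℝ} (hx : CSol n W t0 x) : CSol n W t0 (fun t i => - x t i) := by
  refine ⟨fun i => (hx.1 i).neg, fun i t ht => ?_⟩
  simp only
  rw [hx.2 i t ht, neg_add, ← intervalIntegral.integral_neg]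
  congr 2
  ext s
  rw [← Finset.sum_neg_distrib]
  apply Finset.sum_congr rfl
  intros; ring

lemma csol_max {n : ℕ} {W : ℝ → Fin n → Fin n → ℝ} (hreg : CRegular n W) {t0 : ℝ}
    {x : ℝ → Fin n → ℝ} (hx : CSol n W t0 x) (S : Finset (Fin n)) (g : ℝ → ℝ) (c : ℝ)
    (hg : ∀ t, t0 ≤ t → IntervalIntegrable g volume t0 t)
    (hbd : ∀ i ∈ S, ∀ s, t0 ≤ s → ∑ j ∈ Sᶜ, W s i j * (x s j - x s i) ≤ g s)
    (h0 : ∀ i ∈ S, x t0 i ≤ c) :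
    ∀ t, t0 ≤ t → ∀ i ∈ S, x t i ≤ c + ∫ s in t0..t, g s := by
  intro T hT
  set w : ℝ → ℝ := fun s => ∑ i, ∑ j, W s i j with hw
  have hwi : ∀ a b, IntervalIntegrable w volume a b := by
    intro a b
    have : w = ∑ i, ∑ j, (fun s => W s i j) := by ext s; simp [hw]
    rw [this]
    exact IntervalIntegrable.sum _ fun i _ => IntervalIntegrable.sum _ fun j _ =>
      locInt_ii (hreg.2.2 i j) _ _
  have hw0 : ∀ s, 0 ≤ w s := fun s =>
    Finset.sum_nonneg fun i _ => Finset.sum_nonneg fun j _ => hreg.1 s i j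
  set y : Fin n → ℝ → ℝ := fun i t => x t i - (c + ∫ s in t0..t, g s) with hy
  have hgr : ∀ r t, t0 ≤ r → t0 ≤ t → IntervalIntegrable g volume r t := fun r t hr ht =>
    (hg r hr).symm.trans (hg t ht)
  have hyc : ∀ i, ContinuousOn (y i) (Set.Icc t0 T) := by
    intro i
    refine ((hx.1 i).mono Set.Icc_subset_Ici_self).sub (continuousOn_const.add ?_)
    have := intervalIntegral.continuousOn_primitive_interval' (hg T hT) (Set.left_mem_uIcc)
    rwa [Set.uIcc_of_le hT] at this
  have hyd : ∀ i r t, t0 ≤ r → t0 ≤ t →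
      y i t - y i r = ∫ s in r..t, ((∑ j, W s i j * (x s j - x s i)) - g s) := by
    intro i r t hr ht
    rw [intervalIntegral.integral_sub (csol_ii hreg hx i hr ht) (hgr r t hr ht),
      ← csol_diff hreg hx i hr ht]
    have := intervalIntegral.integral_add_adjacent_intervals (hg r hr) (hgr r t hr ht)
    simp only [hy]
    linarith
  set E : Set ℝ := {t | ∀ i ∈ S, y i t ≤ 0} with hE
  have hclosed : IsClosed (E ∩ Set.Icc t0 T) := by
    have : E ∩ Set.Icc t0 T = Set.Icc t0 T ∩ ⋂ i ∈ S, (Set.Icc t0 T ∩ y i ⁻¹' Set.Iic 0) := by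
      ext t
      simp only [hE, Set.mem_inter_iff, Set.mem_ofPred_eq, Set.mem_iInter, Set.mem_preimage,
        Set.mem_Iic]
      constructor
      · rintro ⟨h1, h2⟩
        exact ⟨h2, fun i hi => ⟨h2, h1 i hi⟩⟩
      · rintro ⟨h1, h2⟩
        exact ⟨fun i hi => (h2 i hi).2, h1⟩
    rw [this]
    refine isClosed_Icc.inter (isClosed_biInter fun i _ => ?_)
    exact (hyc i).preimage_isClosed_of_isClosed isClosed_Icc isClosed_Iic
  have hstart : t0 ∈ E := by
    intro i hi
    simp only [hy, intervalIntegral.integral_same]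
    linarith [h0 i hi]
  have hsub : Set.Icc t0 T ⊆ E := by
    refine hclosed.Icc_subset_of_forall_exists_gt hstart ?_
    rintro a ⟨haE, ha0, haT⟩ b hab
    have hab : a < b := hab
    -- choose z
    have hcw : ContinuousWithinAt (fun z => ∫ s in a..z, w s) (Set.Ici a) a :=
      (intervalIntegral.continuous_primitive hwi a).continuousWithinAt
    have hev : ∀ᶠ z in nhds a, ∫ s in a..z, w s < 1 / 2 := by
      have hc := (intervalIntegral.continuous_primitive hwi a).continuousAt (x := a)
      apply hc.eventually_lt continuousAt_const
      simp
    obtain ⟨z, ⟨hz1, hz2⟩, hza⟩ : ∃ z, (∫ s in a..z, w s < 1 / 2 ∧ z < min b T) ∧ a < z := by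
      have h2 : ∀ᶠ z in nhds a, z < min b T := eventually_lt_nhds (lt_min hab haT)
      exact (((hev.and h2).filter_mono nhdsWithin_le_nhds).and
        (self_mem_nhdsWithin : Set.Ioi a ∈ nhdsWithin a (Set.Ioi a))).exists
    have hzb : z ≤ b := hz2.le.trans (min_le_left _ _)
    have hzT : z ≤ T := hz2.le.trans (min_le_right _ _)
    refine ⟨z, ?_, hza, hzb⟩
    by_contra hzE
    have hzE : ∃ i ∈ S, 0 < y i z := by
      simpa [hE] using hzE
    obtain ⟨i0, hi0, hpos⟩ := hzE
    have hIsub : Set.Icc a z ⊆ Set.Icc t0 T := Set.Icc_subset_Icc ha0 hzT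
    have hex : ∀ i, ∃ t ∈ Set.Icc a z, ∀ s ∈ Set.Icc a z, y i s ≤ y i t := fun i =>
      isCompact_Icc.exists_isMaxOn ⟨a, le_rfl, hza.le⟩ ((hyc i).mono hIsub)
    choose tm htm hmax using hex
    obtain ⟨i, hi, hi'⟩ := Finset.exists_max_image S (fun i => y i (tm i)) ⟨i0, hi0⟩
    set K := y i (tm i) with hK
    have hKpos : 0 < K := hpos.trans_le
      ((hmax i0 z ⟨hza.le, le_rfl⟩).trans (hi' i0 hi0))
    have hle : ∀ j ∈ S, ∀ s ∈ Set.Icc a z, y j s ≤ K := fun j hj s hs =>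
      (hmax j s hs).trans (hi' j hj)
    set t := tm i with ht
    have hta := htm i
    -- last nonpositive time
    have hclo : IsCompact (Set.Icc a t ∩ y i ⁻¹' Set.Iic 0) := by
      apply isCompact_Icc.of_isClosed_subset _ Set.inter_subset_left
      exact ((hyc i).mono (Set.Icc_subset_Icc ha0 (hta.2.trans hzT))).preimage_isClosed_of_isClosed
        isClosed_Icc isClosed_Iic
    obtain ⟨r, ⟨⟨hra, hrt⟩, hr0⟩, hrmax⟩ := hclo.exists_isGreatest
      ⟨a, ⟨le_rfl, hta.1⟩, haE i hi⟩
    have hr0 : y i r ≤ 0 := hr0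
    have hposi : ∀ s ∈ Set.Ioc r t, 0 ≤ y i s := by
      intro s hs
      by_contra hneg
      have := hrmax ⟨⟨hra.trans hs.1.le, hs.2⟩, (not_le.mp hneg).le⟩
      exact absurd hs.1 (not_lt.mpr this)
    have hr00 : t0 ≤ r := ha0.trans hra
    have ht00 : t0 ≤ t := hr00.trans hrt
    have hint : (∫ s in r..t, ((∑ j, W s i j * (x s j - x s i)) - g s)) ≤ ∫ s in r..t, w s * K := by
      apply intervalIntegral.integral_mono_on_of_le_Ioo hrt
        ((csol_ii hreg hx i hr00 ht00).sub (hgr r t hr00 ht00)) ((hwi r t).mul_const K)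
      intro s hs
      have hs0 : t0 ≤ s := hr00.trans hs.1.le
      have hsI : s ∈ Set.Icc a z := ⟨hra.trans hs.1.le, hs.2.le.trans hta.2⟩
      have h1 := hbd i hi s hs0
      rw [← Finset.sum_add_sum_compl S]
      have h2 : ∑ j ∈ S, W s i j * (x s j - x s i) ≤ ∑ j ∈ S, W s i j * K := by
        apply Finset.sum_le_sum
        intro j hj
        apply mul_le_mul_of_nonneg_left _ (hreg.1 s i j)
        have e1 := hle j hj s hsI
        have e2 := hposi s ⟨hs.1, hs.2.le⟩
        simp only [hy] at e1 e2
        linarith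
      have h3 : ∑ j ∈ S, W s i j ≤ w s :=
        (Finset.sum_le_sum_of_subset_of_nonneg (Finset.subset_univ S)
          fun j _ _ => hreg.1 s i j).trans
          (Finset.single_le_sum (f := fun i => ∑ j, W s i j)
            (fun i _ => Finset.sum_nonneg fun j _ => hreg.1 s i j) (Finset.mem_univ i))
      rw [← Finset.sum_mul] at h2
      have h4 := mul_le_mul_of_nonneg_right h3 hKpos.le
      linarith
    rw [← hyd i r t hr00 ht00, intervalIntegral.integral_mul_const] at hint
    have hmono : (∫ s in r..t, w s) ≤ ∫ s in a..z, w s :=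
      intervalIntegral.integral_mono_interval hra hrt hta.2
        (Filter.Eventually.of_forall hw0) (hwi a z)
    have : (∫ s in r..t, w s) * K ≤ 1 / 2 * K :=
      mul_le_mul_of_nonneg_right (hmono.trans hz1.le) hKpos.le
    linarith
  intro i hi
  have := hsub ⟨hT, le_rfl⟩ i hi
  simp only [hy] at this
  linarith

lemma reachIn_of_rtg {α : Type*} {R : α → α → Prop} {a b : α}
    (h : Relation.ReflTransGen R a b) : ∃ k, ReachIn R k a b := by
  induction h using Relation.ReflTransGen.head_induction_on with
  | refl => exact ⟨0, rfl⟩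
  | head h1 _ ih =>
    obtain ⟨k, hk⟩ := ih
    exact ⟨k + 1, _, h1, hk⟩

lemma exists_pred_sets {n : ℕ} (hn : 2 ≤ n) (R : Fin n → Fin n → Prop)
    (h : ¬ ∃ c, ∀ v, ∃ k, ReachIn R k c v) :
    ∃ A B : Finset (Fin n), A.Nonempty ∧ B.Nonempty ∧ Disjoint A B ∧
      (∀ i ∈ A, ∀ j ∉ A, ¬ R j i) ∧ (∀ i ∈ B, ∀ j ∉ B, ¬ R j i) := by
  classical
  let Q := Relation.ReflTransGen R
  obtain ⟨c, -, hc⟩ := Finset.exists_max_image (Finset.univ : Finset (Fin n))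
    (fun c => (Finset.univ.filter fun v => Q c v).card) ⟨⟨0, by omega⟩, Finset.mem_univ _⟩
  push Not at h
  obtain ⟨v, hv⟩ := h c
  have hv : ¬ Q c v := fun hq => by
    obtain ⟨k, hk⟩ := reachIn_of_rtg hq
    exact hv k hk
  refine ⟨Finset.univ.filter fun u => Q u c, Finset.univ.filter fun u => Q u v,
    ⟨c, by simp [Q, Relation.ReflTransGen.refl]⟩, ⟨v, by simp [Q, Relation.ReflTransGen.refl]⟩,
    ?_, ?_, ?_⟩
  · rw [Finset.disjoint_left]
    intro u hu hu'
    have hu : Q u c := by simpa using hu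
    have hu' : Q u v := by simpa using hu'
    have hlt := Finset.card_lt_card (s := Finset.univ.filter fun v => Q c v)
      (t := Finset.univ.filter fun v => Q u v) (by
        refine (Finset.ssubset_iff_of_subset ?_).2 ⟨v, by simpa using hu', by simpa using hv⟩
        intro b hb
        have hb : Q c b := by simpa using hb
        simpa using hu.trans hb)
    exact absurd (hc u (Finset.mem_univ _)) (not_le.mpr hlt)
  · intro i hi j hj hR
    have hi : Q i c := by simpa using hi
    exact hj (by simpa using Relation.ReflTransGen.head hR hi)
  · intro i hi j hj hR
    have hi : Q i v := by simpa using hi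
    exact hj (by simpa using Relation.ReflTransGen.head hR hi)

lemma theta_bd {n : ℕ} {W : ℝ → Fin n → Fin n → ℝ} (hreg : CRegular n W)
    (S : Finset (Fin n)) (hS : ∀ i ∈ S, ∀ j ∉ S, ¬ CPersistent n W j i) (s : ℝ)
    (i : Fin n) (hi : i ∈ S) (d : Fin n → ℝ) (hd : ∀ j, d j ≤ 1) :
    ∑ j ∈ Sᶜ, W s i j * d j ≤ cTheta n W s := by
  classical
  have h1 : ∑ j ∈ Sᶜ, W s i j * d j ≤
      ∑ j ∈ Sᶜ, if j ≠ i ∧ ¬ CPersistent n W j i then W s i j else 0 := by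
    apply Finset.sum_le_sum
    intro j hj
    have hj : j ∉ S := by simpa using hj
    rw [if_pos ⟨fun h => hj (h ▸ hi), hS i hi j hj⟩]
    exact mul_le_of_le_one_right (hreg.1 s i j) (hd j)
  have hnn : ∀ i j, 0 ≤ (if j ≠ i ∧ ¬ CPersistent n W j i then W s i j else 0) := by
    intro i j
    split_ifs
    · exact hreg.1 s i j
    · exact le_rfl
  have h2 := Finset.sum_le_sum_of_subset_of_nonneg (Finset.subset_univ Sᶜ)
    (fun j _ _ => hnn i j)
  have h3 := Finset.single_le_sum
    (f := fun i => ∑ j, if j ≠ i ∧ ¬ CPersistent n W j i then W s i j else 0)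
    (fun i _ => Finset.sum_nonneg fun j _ => hnn i j) (Finset.mem_univ i)
  have := h1.trans (h2.trans h3)
  unfold cTheta
  convert this

lemma theta_tail (f : ℝ → ℝ) (s0 : ℝ) (hs0 : 0 ≤ s0) (hf : IntegrableOn f (Set.Ioi s0)) :
    ∃ t0, 0 ≤ t0 ∧ (∀ t, t0 ≤ t → IntervalIntegrable f volume t0 t) ∧
      ∀ t, t0 ≤ t → ∫ s in t0..t, f s ≤ 1 / 4 := by
  have hii : ∀ a b, s0 ≤ a → a ≤ b → IntervalIntegrable f volume a b := fun a b ha hab =>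
    (intervalIntegrable_iff_integrableOn_Ioc_of_le hab).2
      (hf.mono_set fun s hs => ha.trans_lt hs.1)
  have ht := intervalIntegral_tendsto_integral_Ioi s0 hf tendsto_id
  obtain ⟨N, hN⟩ := Metric.tendsto_atTop.1 ht (1 / 8) (by norm_num)
  refine ⟨max N s0, hs0.trans (le_max_right _ _), fun t h => hii _ _ (le_max_right _ _) h, ?_⟩
  intro t h
  have e1 := hN (max N s0) (le_max_left _ _)
  have e2 := hN t ((le_max_left _ _).trans h)
  have e3 := intervalIntegral.integral_add_adjacent_intervals
    (hii s0 (max N s0) le_rfl (le_max_right _ _)) (hii _ t (le_max_right _ _) h)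
  rw [Real.dist_eq, abs_lt] at e1 e2
  simp only [id] at e1 e2
  linarith [e1.1, e1.2, e2.1, e2.2]

/-- Assuming solutions exist, global agreement implies the persistent graph
is quasi-strongly connected (no arc balance needed). -/
theorem continuous_agreement_implies_qsc
    (n : ℕ) (hn : 2 ≤ n) (W : ℝ → Fin n → Fin n → ℝ)
    (hreg : CRegular n W)
    (hθ : ∃ s : ℝ, 0 ≤ s ∧ IntegrableOn (cTheta n W) (Set.Ioi s))
    (hex : CSolExists n W)
    (hagree : CAgree n W) :
    CQSC n W := by
  classical
  by_contra hcon
  obtain ⟨A, B, ⟨a, ha⟩, ⟨b, hb⟩, hdis, hA, hB⟩ := exists_pred_sets hn _ hcon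
  obtain ⟨s0, hs0, hint⟩ := hθ
  obtain ⟨t0, ht0, hii, htail⟩ := theta_tail _ s0 hs0 hint
  obtain ⟨x, hx, hx0⟩ := hex t0 ht0 (fun i => if i ∈ A then 1 else 0)
  have hxn := csol_neg hx
  have hup : ∀ t, t0 ≤ t → ∀ i, x t i ≤ 1 := by
    intro t ht i
    have := csol_max hreg hx Finset.univ (fun _ => 0) 1 (fun _ _ => by simp) (by simp)
      (fun i _ => by rw [hx0]; split_ifs <;> norm_num) t ht i (Finset.mem_univ i)
    simpa using this
  have hlo : ∀ t, t0 ≤ t → ∀ i, 0 ≤ x t i := by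
    intro t ht i
    have := csol_max hreg hxn Finset.univ (fun _ => 0) 0 (fun _ _ => by simp) (by simp)
      (fun i _ => by rw [hx0]; split_ifs <;> norm_num) t ht i (Finset.mem_univ i)
    simpa using this
  have hxb : ∀ t, t0 ≤ t → x t b ≤ 1 / 4 := by
    intro t ht
    have := csol_max hreg hx B (cTheta n W) 0 hii
      (fun i hi s hs => theta_bd hreg B hB s i hi _
        fun j => by linarith [hup s hs j, hlo s hs i])
      (fun i hi => by
        rw [hx0, if_neg (Finset.disjoint_right.1 hdis hi)]) t ht b hb
    linarith [htail t ht]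
  have hxa : ∀ t, t0 ≤ t → 3 / 4 ≤ x t a := by
    intro t ht
    have := csol_max hreg hxn A (cTheta n W) (-1) hii
      (fun i hi s hs => theta_bd hreg A hA s i hi _
        fun j => by linarith [hup s hs i, hlo s hs j])
      (fun i hi => by
        rw [hx0, if_pos hi]) t ht a ha
    linarith [htail t ht]
  have hlim := hagree t0 ht0 x hx
  have hev := hlim.eventually_lt_const (show (0 : ℝ) < 1 / 2 by norm_num)
  obtain ⟨t, h1, h2⟩ := (hev.and (eventually_ge_atTop t0)).exists
  have e1 : x t a ≤ cMax n x t := le_ciSup (Set.finite_range _).bddAbove a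
  have e2 : cMin n x t ≤ x t b := ciInf_le (Set.finite_range _).bddBelow b
  have := hxa t h2
  have := hxb t h2
  unfold cH at h1
  linarith
end
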